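/- Let A and B be finite nonempty subsets of ℝ × ℝ separated by the vertical line x = m; assume A ∪ B is in general position and all points of A ∪ B have pairwise distinct x-coordinates. Let (a, b) be a supporting pair of (A, B). Then for every edge (p, q) of the upper convex hull of A: (p, q) is an edge of the upper convex hull of A ∪ B if and only if q₁ ≤ a₁. (An edge of the upper hull of the left set survives in the upper hull of the union exactly when it precedes the bridge; this is the correctness of the split/concatenate step for the hulls at a tree node.) -/

import Mathlib

/-- `s` lies on or below the line through `p` and `q` (where `p.1 < q.1`). -/
def OnOrBelow (p q s : ℝ × ℝ) : Prop :=
  (q.1 - p.1) * (s.2 - p.2) ≤ (s.1 - p.1) * (q.2 - p.2)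

/-- `s` lies strictly below the line through `p` and `q`. -/
def StrictlyBelow (p q s : ℝ × ℝ) : Prop :=
  (q.1 - p.1) * (s.2 - p.2) < (s.1 - p.1) * (q.2 - p.2)

/-- `s` lies on or above the line through `p` and `q`. -/
def OnOrAbove (p q s : ℝ × ℝ) : Prop :=
  (q.1 - p.1) * (s.2 - p.2) ≥ (s.1 - p.1) * (q.2 - p.2)

/-- `s` lies on the line through `p` and `q`. -/
def OnLine (p q s : ℝ × ℝ) : Prop :=
  (q.1 - p.1) * (s.2 - p.2) = (s.1 - p.1) * (q.2 - p.2)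

/-- `(p, q)` is an upper supporting pair of the finite set `S`. -/
def UpperSupportingPair (S : Finset (ℝ × ℝ)) (p q : ℝ × ℝ) : Prop :=
  p ∈ S ∧ q ∈ S ∧ p.1 < q.1 ∧ ∀ s ∈ S, OnOrBelow p q s

/-- `A` and `B` are separated by the vertical line `x = m`. -/
def SeparatedBy (A B : Finset (ℝ × ℝ)) (m : ℝ) : Prop :=
  (∀ a ∈ A, a.1 < m) ∧ (∀ b ∈ B, m < b.1)

/-- `(a, b) ∈ A × B` is a supporting pair of `(A, B)`. -/
def SupportingPair (A B : Finset (ℝ × ℝ)) (a b : ℝ × ℝ) : Prop :=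
  a ∈ A ∧ b ∈ B ∧ ∀ s ∈ A ∪ B, OnOrBelow a b s

/-- A finite set is in general position if no three distinct points of it are collinear. -/
def GeneralPosition (S : Finset (ℝ × ℝ)) : Prop :=
  ∀ p ∈ S, ∀ q ∈ S, ∀ r ∈ S, p ≠ q → p ≠ r → q ≠ r →
    ¬ Collinear ℝ ({p, q, r} : Set (ℝ × ℝ))

/-- The slope of the segment from `p` to `q`. -/
noncomputable def segSlope (p q : ℝ × ℝ) : ℝ := (q.2 - p.2) / (q.1 - p.1)

/-- The midpoint of the segment `pq`. -/
noncomputable def midpt (p q : ℝ × ℝ) : ℝ × ℝ := ((p.1 + q.1) / 2, (p.2 + q.2) / 2)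

/-- `p` is an upper-hull vertex of `S`: some non-vertical line through `p`
has every other point of `S` strictly below it. -/
def UpperHullVertex (S : Finset (ℝ × ℝ)) (p : ℝ × ℝ) : Prop :=
  p ∈ S ∧ ∃ k : ℝ, ∀ s ∈ S, s ≠ p → s.2 < p.2 + k * (s.1 - p.1)

/-- `(p, q)` is an edge of the upper convex hull of `S`. -/
def UpperHullEdge (S : Finset (ℝ × ℝ)) (p q : ℝ × ℝ) : Prop :=
  p ∈ S ∧ q ∈ S ∧ p.1 < q.1 ∧ ∀ s ∈ S, s ≠ p → s ≠ q → StrictlyBelow p q s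

theorem onOrBelow_iff_le_segSlope {p q : ℝ × ℝ} (h : p.1 < q.1) (s : ℝ × ℝ) :
    OnOrBelow p q s ↔ s.2 - p.2 ≤ segSlope p q * (s.1 - p.1) := by
  have h' : 0 < q.1 - p.1 := sub_pos.2 h
  rw [OnOrBelow, segSlope, div_mul_eq_mul_div, le_div_iff₀ h', mul_comm (q.1 - p.1),
    mul_comm (s.1 - p.1)]

theorem strictlyBelow_iff_lt_segSlope {p q : ℝ × ℝ} (h : p.1 < q.1) (s : ℝ × ℝ) :
    StrictlyBelow p q s ↔ s.2 - p.2 < segSlope p q * (s.1 - p.1) := by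
  have h' : 0 < q.1 - p.1 := sub_pos.2 h
  rw [StrictlyBelow, segSlope, div_mul_eq_mul_div, lt_div_iff₀ h', mul_comm (q.1 - p.1),
    mul_comm (s.1 - p.1)]

theorem segSlope_mul_sub {p q : ℝ × ℝ} (h : p.1 < q.1) :
    segSlope p q * (q.1 - p.1) = q.2 - p.2 :=
  div_mul_cancel₀ _ (sub_pos.2 h).ne'

theorem collinear_of_eq_mul_sub {p q r : ℝ × ℝ} {k : ℝ} (hq : q.2 - p.2 = k * (q.1 - p.1))
    (hr : r.2 - p.2 = k * (r.1 - p.1)) : Collinear ℝ ({p, q, r} : Set (ℝ × ℝ)) := by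
  rw [collinear_iff_of_mem (p₀ := p) (by simp)]
  refine ⟨(1, k), fun s hs => ⟨s.1 - p.1, ?_⟩⟩
  have hs' : s.2 - p.2 = k * (s.1 - p.1) := by
    rcases hs with rfl | rfl | rfl
    · simp
    · exact hq
    · exact hr
  ext
  · simp
  · simp only [vadd_eq_add, Prod.snd_add, Prod.smul_snd, smul_eq_mul]
    linarith

/-- A hull edge of the left set which precedes the bridge is steeper than the bridge. -/
theorem segSlope_bridge_lt_segSlope_edge {A B : Finset (ℝ × ℝ)} {m : ℝ}
    (hsep : SeparatedBy A B m) (hgp : GeneralPosition (A ∪ B)) {a b p q : ℝ × ℝ}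
    (hab : SupportingPair A B a b) (hpq : UpperHullEdge A p q) (hqa : q.1 ≤ a.1)
    (hx : q ≠ a → q.1 ≠ a.1) : segSlope a b < segSlope p q := by
  obtain ⟨ha, hb, hbelow⟩ := hab
  obtain ⟨hp, hq, hlt, hedge⟩ := hpq
  have hab1 : a.1 < b.1 := (hsep.1 a ha).trans (hsep.2 b hb)
  have hpq_eq := segSlope_mul_sub hlt
  by_cases h : q = a
  · subst h
    have hle := (onOrBelow_iff_le_segSlope hab1 p).1 (hbelow p (Finset.mem_union_left _ hp))
    have hne : p.2 - q.2 ≠ segSlope q b * (p.1 - q.1) := fun he =>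
      hgp q (Finset.mem_union_left _ hq) b (Finset.mem_union_right _ hb) p
        (Finset.mem_union_left _ hp) (fun e => hab1.ne (congrArg Prod.fst e))
        (fun e => hlt.ne' (congrArg Prod.fst e))
        (fun e => (hlt.trans hab1).ne' (congrArg Prod.fst e))
        (collinear_of_eq_mul_sub (segSlope_mul_sub hab1).symm he)
    have hlt' := lt_of_le_of_ne hle hne
    refine lt_of_mul_lt_mul_right ?_ (sub_pos.2 hlt).le
    linarith
  · have hqa' : q.1 < a.1 := lt_of_le_of_ne hqa (hx h)
    have hle := (onOrBelow_iff_le_segSlope hab1 q).1 (hbelow q (Finset.mem_union_left _ hq))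
    have hlt' := (strictlyBelow_iff_lt_segSlope hlt a).1 (hedge a ha
      (fun e => (hlt.trans hqa').ne' (congrArg Prod.fst e)) (Ne.symm h))
    refine lt_of_mul_lt_mul_right ?_ (sub_pos.2 hqa').le
    linarith

theorem left_hull_edge_survives_iff
    (A B : Finset (ℝ × ℝ)) (m : ℝ) (hA : A.Nonempty) (hB : B.Nonempty)
    (hsep : SeparatedBy A B m) (hgp : GeneralPosition (A ∪ B))
    (hx : ∀ p ∈ A ∪ B, ∀ q ∈ A ∪ B, p ≠ q → p.1 ≠ q.1)
    (a b : ℝ × ℝ) (hab : SupportingPair A B a b) :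
    ∀ p q : ℝ × ℝ, UpperHullEdge A p q →
      (UpperHullEdge (A ∪ B) p q ↔ q.1 ≤ a.1) := by
  intro p q hpq
  have hslope := segSlope_bridge_lt_segSlope_edge hsep hgp hab hpq
  obtain ⟨ha, hb, hbelow⟩ := hab
  obtain ⟨hp, hq, hlt, hedge⟩ := hpq
  have hab1 : a.1 < b.1 := (hsep.1 a ha).trans (hsep.2 b hb)
  have hpq_eq := segSlope_mul_sub hlt
  have hab_eq := segSlope_mul_sub hab1
  have hne : ∀ r ∈ A, ∀ s ∈ B, s ≠ r := fun r hr s hs e =>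
    ((hsep.1 r hr).trans (hsep.2 s hs)).ne' (congrArg Prod.fst e)
  have ha_le : a ≠ q → a.2 - p.2 ≤ segSlope p q * (a.1 - p.1) := by
    intro haq
    by_cases hap : a = p
    · simp [hap]
    · exact ((strictlyBelow_iff_lt_segSlope hlt a).1 (hedge a ha hap haq)).le
  constructor
  · intro h
    by_contra! haq
    have hb_lt := (strictlyBelow_iff_lt_segSlope hlt b).1
      (h.2.2.2 b (Finset.mem_union_right _ hb) (hne p hp b hb) (hne q hq b hb))
    have hq_le := (onOrBelow_iff_le_segSlope hab1 q).1 (hbelow q (Finset.mem_union_left _ hq))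
    have ha_le' := ha_le (fun e => haq.ne (congrArg Prod.fst e))
    have hqb : q.1 < b.1 := (hsep.1 q hq).trans (hsep.2 b hb)
    have h₁ : segSlope p q * (q.1 - a.1) ≤ segSlope a b * (q.1 - a.1) := by linarith
    have h₂ : segSlope a b * (b.1 - q.1) < segSlope p q * (b.1 - q.1) := by linarith
    exact (le_of_mul_le_mul_right h₁ (sub_pos.2 haq)).not_gt
      (lt_of_mul_lt_mul_right h₂ (sub_pos.2 hqb).le)
  · intro hqa
    refine ⟨Finset.mem_union_left _ hp, Finset.mem_union_left _ hq, hlt, fun s hs hsp hsq => ?_⟩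
    rcases Finset.mem_union.1 hs with hsA | hsB
    · exact hedge s hsA hsp hsq
    · have hs_le := (onOrBelow_iff_le_segSlope hab1 s).1 (hbelow s hs)
      have has : a.1 < s.1 := (hsep.1 a ha).trans (hsep.2 s hsB)
      have hmul := mul_lt_mul_of_pos_right
        (hslope hqa (hx q (Finset.mem_union_left _ hq) a (Finset.mem_union_left _ ha)))
        (sub_pos.2 has)
      have ha_le' : a.2 - p.2 ≤ segSlope p q * (a.1 - p.1) := by
        by_cases haq : a = q
        · rw [haq, hpq_eq]
        · exact ha_le haq
      rw [strictlyBelow_iff_lt_segSlope hlt]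
      linarith
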